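/- Let Z be a real random variable with standard Gaussian distribution N(0, 1), let c ∈ ℝ, and set m = φ(c)/(1 − Φ(c)). Then the random variable W = Z·1_{Z < c} + m·1_{Z ≥ c} has mean E[W] = 0 and variance Var(W) = h(c), where h is the censoring adjustment function. -/

import Mathlib

open MeasureTheory ProbabilityTheory Real

/-- The standard normal density. -/
noncomputable def normPDF (t : ℝ) : ℝ := Real.exp (-t ^ 2 / 2) / Real.sqrt (2 * Real.pi)

/-- The standard normal cumulative distribution function. -/
noncomputable def normCDF (t : ℝ) : ℝ := ∫ s in Set.Iic t, normPDF s

/-- The censoring adjustment function `h(z) = Φ(z) − z·φ(z) + φ(z)²/(1 − Φ(z))`. -/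
noncomputable def censorAdj (z : ℝ) : ℝ :=
  normCDF z - z * normPDF z + (normPDF z) ^ 2 / (1 - normCDF z)

theorem normPDF_eq_gaussianPDFReal : normPDF = gaussianPDFReal 0 1 := by
  ext t
  simp [normPDF, gaussianPDFReal, div_eq_inv_mul]

theorem normPDF_pos (t : ℝ) : 0 < normPDF t := by
  unfold normPDF
  positivity

theorem integrable_normPDF : Integrable normPDF := by
  rw [normPDF_eq_gaussianPDFReal]
  exact integrable_gaussianPDFReal 0 1

theorem integrable_mul_normPDF : Integrable fun t => t * normPDF t := by
  convert (integrable_mul_exp_neg_mul_sq (b := 1 / 2) (by norm_num)).div_const (√(2 * π)) using 2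
    with t
  rw [normPDF, mul_div_assoc]
  ring_nf

theorem integrable_sq_mul_normPDF : Integrable fun t => t ^ 2 * normPDF t := by
  convert (integrable_rpow_mul_exp_neg_mul_sq (b := 1 / 2) (s := 2) (by norm_num)
    (by norm_num)).div_const (√(2 * π)) using 2 with t
  rw [normPDF, mul_div_assoc, rpow_two]
  ring_nf

theorem hasDerivAt_normPDF (t : ℝ) : HasDerivAt normPDF (-(t * normPDF t)) t := by
  have h : HasDerivAt (fun s : ℝ => -s ^ 2 / 2) (-t) t :=
    ((hasDerivAt_pow 2 t).fun_neg.div_const 2).congr_deriv (by norm_num; ring)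
  refine (h.exp.div_const √(2 * π)).congr_deriv ?_
  rw [normPDF]
  ring

theorem hasDerivAt_mul_normPDF (t : ℝ) :
    HasDerivAt (fun s => s * normPDF s) (normPDF t - t ^ 2 * normPDF t) t :=
  ((hasDerivAt_id' t).fun_mul (hasDerivAt_normPDF t)).congr_deriv (by ring)

theorem integral_Iic_eq_of_hasDerivAt_of_integrable {f f' : ℝ → ℝ} (c : ℝ)
    (hderiv : ∀ t, HasDerivAt f (f' t) t) (hf : Integrable f) (hf' : Integrable f') :
    ∫ t in Set.Iic c, f' t = f c := by
  rw [integral_Iic_of_hasDerivAt_of_tendsto' (fun t _ => hderiv t) hf'.integrableOn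
    (tendsto_zero_of_hasDerivAt_of_integrableOn_Iic (a := c) (fun t _ => hderiv t)
      hf'.integrableOn hf.integrableOn), sub_zero]

theorem integral_Iic_mul_normPDF (c : ℝ) :
    ∫ t in Set.Iic c, t * normPDF t = -normPDF c := by
  have h := integral_Iic_eq_of_hasDerivAt_of_integrable c hasDerivAt_normPDF integrable_normPDF
    integrable_mul_normPDF.neg
  rw [integral_neg] at h
  linarith

theorem integral_Iic_sq_mul_normPDF (c : ℝ) :
    ∫ t in Set.Iic c, t ^ 2 * normPDF t = normCDF c - c * normPDF c := by
  have h := integral_Iic_eq_of_hasDerivAt_of_integrable c hasDerivAt_mul_normPDF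
    integrable_mul_normPDF (integrable_normPDF.sub integrable_sq_mul_normPDF)
  rw [integral_sub integrable_normPDF.integrableOn integrable_sq_mul_normPDF.integrableOn,
    ← normCDF] at h
  linarith

theorem integral_Ioi_normPDF (c : ℝ) : ∫ t in Set.Ioi c, normPDF t = 1 - normCDF c := by
  have h := intervalIntegral.integral_Iic_add_Ioi (b := c) integrable_normPDF.integrableOn
    integrable_normPDF.integrableOn
  have h1 : ∫ t, normPDF t = 1 := by
    rw [normPDF_eq_gaussianPDFReal]
    exact integral_gaussianPDFReal_eq_one 0 one_ne_zero
  rw [h1, ← normCDF] at h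
  linarith

theorem normCDF_lt_one (c : ℝ) : normCDF c < 1 := by
  rw [← sub_pos, ← integral_Ioi_normPDF, setIntegral_pos_iff_support_of_nonneg_ae
    (Filter.Eventually.of_forall fun t => (normPDF_pos t).le) integrable_normPDF.integrableOn]
  have : Function.support normPDF = Set.univ :=
    Set.eq_univ_of_forall fun t => (normPDF_pos t).ne'
  simp [this]

theorem integral_ite_lt_gaussianReal (c k : ℝ) {g : ℝ → ℝ}
    (hg : Integrable fun t => g t * normPDF t) :
    ∫ t, (if t < c then g t else k) ∂gaussianReal 0 1
      = (∫ t in Set.Iic c, g t * normPDF t) + k * (1 - normCDF c) := by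
  have hIio : Set.EqOn (fun t => normPDF t • if t < c then g t else k)
      (fun t => g t * normPDF t) (Set.Iio c) := fun t ht => by
    simp [if_pos (Set.mem_Iio.mp ht), mul_comm]
  have hIci : Set.EqOn (fun t => normPDF t • if t < c then g t else k)
      (fun t => k * normPDF t) (Set.Ici c) := fun t ht => by
    simp [if_neg (not_lt.mpr (Set.mem_Ici.mp ht)), mul_comm]
  rw [integral_gaussianReal_eq_integral_smul one_ne_zero, ← normPDF_eq_gaussianPDFReal,
    ← intervalIntegral.integral_Iio_add_Ici (b := c)
      ((integrableOn_congr_fun hIio measurableSet_Iio).mpr hg.integrableOn)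
      ((integrableOn_congr_fun hIci measurableSet_Ici).mpr
        (integrable_normPDF.const_mul k).integrableOn),
    setIntegral_congr_fun measurableSet_Iio hIio, setIntegral_congr_fun measurableSet_Ici hIci,
    integral_const_mul, integral_Ici_eq_integral_Ioi, integral_Ioi_normPDF,
    integral_Iic_eq_integral_Iio]

/-- For standard Gaussian `Z` and `m = φ(c)/(1 − Φ(c))`, the random variable
`W = Z·1_{Z < c} + m·1_{Z ≥ c}` has mean `0` and variance `h(c)`. -/
theorem censored_standard_gaussian_mean_variance
    {Ω : Type*} [MeasurableSpace Ω] (P : Measure Ω) [IsProbabilityMeasure P]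
    (Z W : Ω → ℝ) (hZm : Measurable Z) (c : ℝ)
    (hZ : Measure.map Z P = gaussianReal 0 1)
    (hW : ∀ ω, W ω = if Z ω < c then Z ω else normPDF c / (1 - normCDF c)) :
    (∫ ω, W ω ∂P) = 0
      ∧ (∫ ω, (W ω) ^ 2 ∂P) - (∫ ω, W ω ∂P) ^ 2 = censorAdj c := by
  set m := normPDF c / (1 - normCDF c) with hm
  have hpos : 1 - normCDF c ≠ 0 := (sub_pos.mpr (normCDF_lt_one c)).ne'
  have hmean : ∫ ω, W ω ∂P = 0 := by
    have hmeas : Measurable fun t : ℝ => if t < c then t else m :=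
      measurable_id.ite measurableSet_Iio measurable_const
    simp_rw [hW]
    rw [← integral_map (f := fun t : ℝ => if t < c then t else m) hZm.aemeasurable
      hmeas.aestronglyMeasurable, hZ, integral_ite_lt_gaussianReal c m integrable_mul_normPDF,
      integral_Iic_mul_normPDF, hm, div_mul_cancel₀ _ hpos, neg_add_cancel]
  have hsq : ∫ ω, W ω ^ 2 ∂P = censorAdj c := by
    have hmeas : Measurable fun t : ℝ => if t < c then t ^ 2 else m ^ 2 :=
      (measurable_id.pow_const 2).ite measurableSet_Iio measurable_const
    simp_rw [hW, ite_pow]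
    rw [← integral_map (f := fun t : ℝ => if t < c then t ^ 2 else m ^ 2) hZm.aemeasurable
      hmeas.aestronglyMeasurable, hZ,
      integral_ite_lt_gaussianReal c (m ^ 2) integrable_sq_mul_normPDF,
      integral_Iic_sq_mul_normPDF, hm, censorAdj]
    field_simp
  exact ⟨hmean, by rw [hmean, hsq]; ring⟩
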